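/- Let G be a simple graph, let d ≥ 2 be an even integer, let k ≥ d be an integer, and let ℓ_0, ℓ_1, …, ℓ_d be vertices of G such that ℓ_i is adjacent to ℓ_{i+1} for every 0 ≤ i < d, the odd-indexed vertices ℓ_1, ℓ_3, …, ℓ_{d-1} are pairwise distinct, no two of them are adjacent in G, and each of them is different from ℓ_0 and from ℓ_d. Suppose that for each odd index i with 0 < i < d there are a simple graph H_i and a function p_i assigning to each vertex of G a (possibly empty) set of vertices of H_i such that: (1) whenever u and v are adjacent in G, every x ∈ p_i(u) and every y ∈ p_i(v) satisfy x = y or x and y are adjacent in H_i; (2) for every vertex v of G, p_i(v) = ∅ if and only if v = ℓ_i; and (3) every walk in H_i from a point of p_i(ℓ_0) to a point of p_i(ℓ_d) has length strictly greater than k. Then every walk in G from ℓ_0 to ℓ_d of length at most k contains every odd-indexed vertex ℓ_i in its support, and the graph distance in G from ℓ_0 to ℓ_d equals d. -/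

import Mathlib

namespace SimpleGraph

/-- A set-valued map with nonempty values along a walk that sends adjacent vertices to equal or
adjacent points carries the walk to one that is no longer. -/
theorem Walk.exists_walk_length_le_of_setValued {V W : Type*} {G : SimpleGraph V}
    {H : SimpleGraph W} {p : V → Set W}
    (hp : ∀ u v, G.Adj u v → ∀ x ∈ p u, ∀ y ∈ p v, x = y ∨ H.Adj x y) {u v : V}
    (w : G.Walk u v) (hne : ∀ a ∈ w.support, (p a).Nonempty) {x : W} (hx : x ∈ p u) :
    ∃ y ∈ p v, ∃ q : H.Walk x y, q.length ≤ w.length := by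
  induction w generalizing x with
  | nil => exact ⟨x, hx, .nil, le_rfl⟩
  | cons h w ih =>
    obtain ⟨z, hz⟩ := hne _ (List.mem_cons_of_mem _ w.start_mem_support)
    obtain ⟨y, hy, q, hq⟩ := ih (fun a ha ↦ hne a (List.mem_cons_of_mem _ ha)) hz
    rcases hp _ _ h x hx z hz with rfl | hadj
    · exact ⟨y, hy, q, hq.trans (Nat.le_succ _)⟩
    · exact ⟨y, hy, .cons hadj q, Nat.succ_le_succ hq⟩

theorem exists_walk_length_eq_of_adj_succ {V : Type*} {G : SimpleGraph V} {ℓ : ℕ → V} {n : ℕ}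
    (h : ∀ i < n, G.Adj (ℓ i) (ℓ (i + 1))) : ∃ w : G.Walk (ℓ 0) (ℓ n), w.length = n := by
  induction n with
  | zero => exact ⟨.nil, rfl⟩
  | succ n ih =>
    obtain ⟨w, hw⟩ := ih fun i hi ↦ h i (hi.trans n.lt_succ_self)
    exact ⟨w.concat (h n n.lt_succ_self), by rw [Walk.length_concat, hw]⟩

/-- A walk through `m ≥ 1` distinct, pairwise nonadjacent vertices other than its ends has
length at least `2 * m`. -/
theorem Walk.two_mul_le_length_of_mem_support {V : Type*} {G : SimpleGraph V} {u v : V}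
    (w : G.Walk u v) {m : ℕ} (hm : 0 < m) {f : ℕ → V}
    (hmem : ∀ i < m, f i ∈ w.support) (hends : ∀ i < m, f i ≠ u ∧ f i ≠ v)
    (hne : ∀ i < m, ∀ j < m, i ≠ j → f i ≠ f j)
    (hnadj : ∀ i < m, ∀ j < m, i ≠ j → ¬ G.Adj (f i) (f j)) : 2 * m ≤ w.length := by
  by_contra! hlt
  have hex : ∀ i, ∃ t, i < m → w.getVert t = f i ∧ 0 < t ∧ t < w.length := by
    intro i
    by_cases hi : i < m
    · obtain ⟨t, ht, htl⟩ := Walk.mem_support_iff_exists_getVert.1 (hmem i hi)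
      refine ⟨t, fun _ ↦ ⟨ht, Nat.pos_of_ne_zero ?_, lt_of_le_of_ne htl ?_⟩⟩
      · rintro rfl
        exact (hends i hi).1 (ht.symm.trans w.getVert_zero)
      · rintro rfl
        exact (hends i hi).2 (ht.symm.trans w.getVert_length)
    · exact ⟨0, fun h ↦ absurd h hi⟩
  choose t ht using hex
  -- Two of the `m` positions lie in a common block `{2 * b + 1, 2 * b + 2}` with `b < m - 1`.
  obtain ⟨i, hi, j, hj, hij, hb⟩ := Finset.exists_ne_map_eq_of_card_lt_of_maps_to
    (s := Finset.range m) (t := Finset.range (m - 1)) (f := fun i ↦ (t i - 1) / 2)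
    (by simpa using hm) (by
      intro i hi
      have := ht i (by simpa using hi)
      simp only [Finset.coe_range, Set.mem_Iio]
      omega)
  rw [Finset.mem_range] at hi hj
  obtain ⟨hti, hi0, hil⟩ := ht i hi
  obtain ⟨htj, hj0, hjl⟩ := ht j hj
  have hcases : t i = t j ∨ t j = t i + 1 ∨ t i = t j + 1 := by omega
  rcases hcases with h | h | h
  · exact hne i hi j hj hij (by rw [← hti, ← htj, h])
  · exact hnadj i hi j hj hij (by rw [← hti, ← htj, h]; exact w.adj_getVert_succ hil)
  · exact hnadj j hj i hi hij.symm (by rw [← hti, ← htj, h]; exact w.adj_getVert_succ hjl)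

end SimpleGraph


/-- The full abstract form of the flexipath lemma: projections to the graphs
`H_i` force every walk of length at most `k` from `ℓ 0` to `ℓ d` to pass
through every odd-indexed vertex, and the graph distance from `ℓ 0` to `ℓ d`
equals `d`. -/
theorem stmt_6 {V : Type*} (G : SimpleGraph V) (d k : ℕ) (hd : 2 ≤ d)
    (hde : Even d) (hk : d ≤ k) (ℓ : ℕ → V)
    (hadj : ∀ i < d, G.Adj (ℓ i) (ℓ (i + 1)))
    (hdistinct : ∀ i j, Odd i → Odd j → i < d → j < d → i ≠ j → ℓ i ≠ ℓ j)
    (hnadj : ∀ i j, Odd i → Odd j → i < d → j < d → i ≠ j →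
      ¬ G.Adj (ℓ i) (ℓ j))
    (hends : ∀ i, Odd i → i < d → ℓ i ≠ ℓ 0 ∧ ℓ i ≠ ℓ d)
    (hproj : ∀ i, Odd i → i < d →
      ∃ (W : Type) (H : SimpleGraph W) (p : V → Set W),
        (∀ u v : V, G.Adj u v → ∀ x ∈ p u, ∀ y ∈ p v, x = y ∨ H.Adj x y) ∧
        (∀ v : V, p v = ∅ ↔ v = ℓ i) ∧
        (∀ x ∈ p (ℓ 0), ∀ y ∈ p (ℓ d), ∀ q : H.Walk x y, k < q.length)) :
    (∀ W : G.Walk (ℓ 0) (ℓ d), W.length ≤ k →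
      ∀ i, Odd i → i < d → ℓ i ∈ W.support) ∧
    G.dist (ℓ 0) (ℓ d) = d := by
  have hpass : ∀ W : G.Walk (ℓ 0) (ℓ d), W.length ≤ k →
      ∀ i, Odd i → i < d → ℓ i ∈ W.support := by
    intro w hw i hi hid
    by_contra hnot
    obtain ⟨W, H, p, hp, hempty, hfar⟩ := hproj i hi hid
    have hne : ∀ a ∈ w.support, (p a).Nonempty := fun a ha ↦
      Set.nonempty_iff_ne_empty.2 fun h ↦ hnot ((hempty a).1 h ▸ ha)
    obtain ⟨x, hx⟩ := hne _ w.start_mem_support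
    obtain ⟨y, hy, q, hq⟩ := w.exists_walk_length_le_of_setValued hp hne hx
    exact absurd (hfar x hx y hy q) (by omega)
  refine ⟨hpass, ?_⟩
  obtain ⟨w₀, hw₀⟩ := SimpleGraph.exists_walk_length_eq_of_adj_succ hadj
  have hle : G.dist (ℓ 0) (ℓ d) ≤ d := (SimpleGraph.dist_le w₀).trans_eq hw₀
  refine hle.antisymm ?_
  obtain ⟨w, hw⟩ := w₀.reachable.exists_walk_length_eq_dist
  obtain ⟨m, rfl⟩ := hde.two_dvd
  have hodd : ∀ i, Odd (2 * i + 1) := fun i ↦ odd_two_mul_add_one i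
  rw [← hw]
  refine w.two_mul_le_length_of_mem_support (by omega) (f := fun i ↦ ℓ (2 * i + 1))
    (fun i hi ↦ hpass w (by omega) _ (hodd i) (by omega))
    (fun i hi ↦ hends _ (hodd i) (by omega))
    (fun i hi j hj hij ↦ hdistinct _ _ (hodd i) (hodd j) (by omega) (by omega) (by omega))
    (fun i hi j hj hij ↦ hnadj _ _ (hodd i) (hodd j) (by omega) (by omega) (by omega))
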